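/- Let Δ be the root system of type A_{n−1} with simple roots α₁, …, α_{n−1} in the standard order (so (αᵢ,αⱼ) ≠ 0 exactly when |i−j| ≤ 1), let 1 ≤ k ≤ n−1, and set A = {α_k} and B = {α₁, …, α_{k−1}}. Then every (A,B)-root is significant and ℓ(A,B) = k. -/

import Mathlib

open scoped RealInnerProductSpace
open scoped Classical

/-- A reduced crystallographic root system `roots` spanning a real inner product
space `V`, with a chosen set `pos` of positive roots, the corresponding base
`simple` of simple roots, and the coefficient function `coeff`, where
`coeff ξ α = c_α(ξ)` is the coefficient of the simple root `α` in the unique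
expression `ξ = ∑_{α ∈ simple} c_α(ξ) • α`. -/
structure RootSystemData (V : Type*) [NormedAddCommGroup V] [InnerProductSpace ℝ V] where
  roots : Finset V
  pos : Finset V
  simple : Finset V
  coeff : V → V → ℝ
  pos_subset : pos ⊆ roots
  simple_subset : simple ⊆ pos
  root_ne_zero : ∀ δ ∈ roots, δ ≠ (0 : V)
  neg_mem : ∀ δ ∈ roots, -δ ∈ roots
  pos_or_neg : ∀ δ ∈ roots, δ ∈ pos ∨ -δ ∈ pos
  pos_neg_not : ∀ δ ∈ pos, -δ ∉ pos
  reduced : ∀ δ ∈ roots, ∀ t : ℝ, t • δ ∈ roots → t = 1 ∨ t = -1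
  crystallographic : ∀ δ ∈ roots, ∀ ε ∈ roots, ∃ n : ℤ, 2 * ⟪δ, ε⟫ / ⟪ε, ε⟫ = (n : ℝ)
  reflect_mem : ∀ δ ∈ roots, ∀ ε ∈ roots, δ - (2 * ⟪δ, ε⟫ / ⟪ε, ε⟫) • ε ∈ roots
  span_eq_top : Submodule.span ℝ (simple : Set V) = ⊤
  linearIndependent : LinearIndependent ℝ (fun α : simple => (α : V))
  coeff_spec : ∀ ξ : V, ξ = ∑ α ∈ simple, coeff ξ α • α
  pos_coeff_nonneg : ∀ δ ∈ pos, ∀ α ∈ simple, 0 ≤ coeff δ α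

namespace RootSystemData

variable {V : Type*} [NormedAddCommGroup V] [InnerProductSpace ℝ V]

/-- The support `C(ξ)` of `ξ`: the set of simple roots with nonzero coefficient in `ξ`. -/
noncomputable def support (R : RootSystemData V) (ξ : V) : Finset V :=
  R.simple.filter fun α => R.coeff ξ α ≠ 0

/-- The coefficientwise partial order: `x ≤ y` iff `c_α(x) ≤ c_α(y)` for all simple `α`. -/
def cle (R : RootSystemData V) (x y : V) : Prop :=
  ∀ α ∈ R.simple, R.coeff x α ≤ R.coeff y α

/-- An `(A,B)`-root: a positive root whose support lies in `A ∪ B` and which has a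
strictly positive coefficient at some element of `A`. -/
def IsABRoot (R : RootSystemData V) (A B : Finset V) (δ : V) : Prop :=
  δ ∈ R.pos ∧ R.support δ ⊆ A ∪ B ∧ ∃ α₀ ∈ A, 0 < R.coeff δ α₀

/-- A significant `(A,B)`-root. -/
def IsSignificant (R : RootSystemData V) (A B : Finset V) (δ : V) : Prop :=
  R.IsABRoot A B δ ∧ ∃ σ : V, R.IsABRoot A B σ ∧ R.cle σ δ ∧
    (∑ β ∈ B, R.coeff σ β * ⟪β, β⟫) ≤ (∑ α ∈ A, R.coeff σ α * ⟪α, α⟫) ∧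
    (∀ x ∈ R.support (δ - σ), ∀ y ∈ R.support (δ - σ), ‖x‖ = ‖y‖) ∧
    (∀ x ∈ R.support (δ - σ), ‖x‖ ≤ ‖σ‖)

/-- `ℓ(A,B)`, the number of significant `(A,B)`-roots. -/
noncomputable def ell (R : RootSystemData V) (A B : Finset V) : ℕ :=
  (R.pos.filter fun δ => R.IsSignificant A B δ).card

/-- `γ`, the half-sum of the positive roots. -/
noncomputable def gamma (R : RootSystemData V) : V :=
  (2 : ℝ)⁻¹ • ∑ δ ∈ R.pos, δ

/-- A weight: `2(β,α)/(α,α) ∈ ℤ` for all roots `α`. -/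
def IsWeight (R : RootSystemData V) (β : V) : Prop :=
  ∀ δ ∈ R.roots, ∃ n : ℤ, 2 * ⟪β, δ⟫ / ⟪δ, δ⟫ = (n : ℝ)

/-- A regular weight: not orthogonal to any positive root. -/
def IsRegular (R : RootSystemData V) (lam : V) : Prop :=
  ∀ δ ∈ R.pos, ⟪lam, δ⟫ ≠ 0

end RootSystemData


namespace RootSystemData

variable {V : Type*} [NormedAddCommGroup V] [InnerProductSpace ℝ V] (R : RootSystemData V)

theorem coeff_unique {ξ : V} {f : V → ℝ} (h : ξ = ∑ β ∈ R.simple, f β • β) {γ : V}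
    (hγ : γ ∈ R.simple) : R.coeff ξ γ = f γ := by
  have hli := Fintype.linearIndependent_iff.1 R.linearIndependent
    (fun β => R.coeff ξ β - f β) (by
      rw [Finset.sum_coe_sort R.simple (fun β => (R.coeff ξ β - f β) • β)]
      simp only [sub_smul, Finset.sum_sub_distrib]
      rw [← h, ← R.coeff_spec ξ, sub_self])
  exact sub_eq_zero.1 (hli ⟨γ, hγ⟩)

theorem coeff_sub (x y : V) {γ : V} (hγ : γ ∈ R.simple) :
    R.coeff (x - y) γ = R.coeff x γ - R.coeff y γ :=
  R.coeff_unique (f := fun β => R.coeff x β - R.coeff y β) (by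
    simp only [sub_smul, Finset.sum_sub_distrib]
    rw [← R.coeff_spec x, ← R.coeff_spec y]) hγ

theorem coeff_add (x y : V) {γ : V} (hγ : γ ∈ R.simple) :
    R.coeff (x + y) γ = R.coeff x γ + R.coeff y γ :=
  R.coeff_unique (f := fun β => R.coeff x β + R.coeff y β) (by
    simp only [add_smul, Finset.sum_add_distrib]
    rw [← R.coeff_spec x, ← R.coeff_spec y]) hγ

theorem coeff_smul (t : ℝ) (x : V) {γ : V} (hγ : γ ∈ R.simple) :
    R.coeff (t • x) γ = t * R.coeff x γ :=
  R.coeff_unique (f := fun β => t * R.coeff x β) (by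
    simp only [mul_smul, ← Finset.smul_sum]
    rw [← R.coeff_spec x]) hγ

theorem coeff_zero {γ : V} (hγ : γ ∈ R.simple) : R.coeff 0 γ = 0 :=
  R.coeff_unique (f := fun _ => 0) (by simp) hγ

theorem coeff_simple {β γ : V} (hβ : β ∈ R.simple) (hγ : γ ∈ R.simple) :
    R.coeff β γ = if γ = β then 1 else 0 :=
  R.coeff_unique (f := fun γ => if γ = β then 1 else 0) (by simp [ite_smul, hβ]) hγ

theorem ne_zero_of_mem_simple {β : V} (hβ : β ∈ R.simple) : β ≠ 0 :=
  R.root_ne_zero β (R.pos_subset (R.simple_subset hβ))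

/-- A simple reflection permutes the positive roots other than the simple root itself. -/
theorem reflect_mem_pos {δ β : V} (hδ : δ ∈ R.pos) (hβ : β ∈ R.simple) (hne : δ ≠ β) :
    δ - (2 * ⟪δ, β⟫ / ⟪β, β⟫) • β ∈ R.pos := by
  have hβr := R.pos_subset (R.simple_subset hβ)
  have hroot := R.reflect_mem δ (R.pos_subset hδ) β hβr
  set t := 2 * ⟪δ, β⟫ / ⟪β, β⟫
  refine (R.pos_or_neg _ hroot).resolve_right fun hneg => hne ?_
  have hzero : ∀ γ ∈ R.simple, γ ≠ β → R.coeff δ γ = 0 := by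
    intro γ hγ hγβ
    have h1 := R.pos_coeff_nonneg _ hneg γ hγ
    have h2 := R.pos_coeff_nonneg _ hδ γ hγ
    rw [neg_sub, R.coeff_sub _ _ hγ, R.coeff_smul _ _ hγ, R.coeff_simple hβ hγ,
      if_neg hγβ] at h1
    linarith
  have hmul : δ = R.coeff δ β • β := by
    conv_lhs => rw [R.coeff_spec δ]
    exact Finset.sum_eq_single_of_mem β hβ fun γ hγ h => by rw [hzero γ hγ h, zero_smul]
  have hnonneg := R.pos_coeff_nonneg _ hδ β hβ
  rcases R.reduced β hβr (R.coeff δ β) (hmul ▸ R.pos_subset hδ) with h | h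
  · rw [hmul, h, one_smul]
  · linarith

theorem exists_simple_inner_pos {δ : V} (hδ : δ ∈ R.pos) : ∃ β ∈ R.simple, 0 < ⟪δ, β⟫ := by
  by_contra! h
  have hpos : 0 < ⟪δ, δ⟫ := real_inner_self_pos.2 (R.root_ne_zero δ (R.pos_subset hδ))
  have hsum : ⟪δ, δ⟫ = ∑ β ∈ R.simple, R.coeff δ β * ⟪δ, β⟫ := by
    conv_lhs => rw [R.coeff_spec δ, inner_sum]
    rw [← R.coeff_spec δ]
    simp only [real_inner_smul_right]
  have hle : ∑ β ∈ R.simple, R.coeff δ β * ⟪δ, β⟫ ≤ 0 :=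
    Finset.sum_nonpos fun β hβ =>
      mul_nonpos_of_nonneg_of_nonpos (R.pos_coeff_nonneg δ hδ β hβ) (h β hβ)
  linarith

/-- Every positive root is reached from a simple root by simple reflections through positive
roots. -/
theorem pos_induction {P : V → Prop} (simple : ∀ β ∈ R.simple, P β)
    (reflect : ∀ δ ∈ R.pos, ∀ β ∈ R.simple, δ - (2 * ⟪δ, β⟫ / ⟪β, β⟫) • β ∈ R.pos →
      P δ → P (δ - (2 * ⟪δ, β⟫ / ⟪β, β⟫) • β)) : ∀ δ ∈ R.pos, P δ := by
  by_contra! hex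
  obtain ⟨δ₀, hδ₀, hP₀⟩ := hex
  obtain ⟨δ, hδ, hmin⟩ := Finset.exists_min_image (R.pos.filter fun δ => ¬ P δ)
    (fun δ => ∑ β ∈ R.simple, R.coeff δ β) ⟨δ₀, Finset.mem_filter.2 ⟨hδ₀, hP₀⟩⟩
  obtain ⟨hδ, hP⟩ := Finset.mem_filter.1 hδ
  obtain ⟨β, hβ, hinner⟩ := R.exists_simple_inner_pos hδ
  have hββ : 0 < ⟪β, β⟫ := real_inner_self_pos.2 (R.ne_zero_of_mem_simple hβ)
  have hne : δ ≠ β := fun h => hP (h ▸ simple β hβ)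
  have hs := R.reflect_mem_pos hδ hβ hne
  obtain ⟨t, ht⟩ : ∃ t, t = 2 * ⟪δ, β⟫ / ⟪β, β⟫ := ⟨_, rfl⟩
  rw [← ht] at hs
  have ht0 : 0 < t := ht ▸ by positivity
  have hback : δ - t • β - (2 * ⟪δ - t • β, β⟫ / ⟪β, β⟫) • β = δ := by
    have : 2 * ⟪δ - t • β, β⟫ / ⟪β, β⟫ = -t := by
      rw [inner_sub_left, real_inner_smul_left, ht]
      field_simp
      ring
    rw [this]
    module
  have hPs : P (δ - t • β) := by
    by_contra hPs
    have h := hmin _ (Finset.mem_filter.2 ⟨hs, hPs⟩)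
    have hheight : ∑ γ ∈ R.simple, R.coeff (δ - t • β) γ
        = ∑ γ ∈ R.simple, R.coeff δ γ - t := by
      rw [Finset.sum_congr rfl fun γ hγ => by
        rw [R.coeff_sub _ _ hγ, R.coeff_smul _ _ hγ, R.coeff_simple hβ hγ]]
      simp [Finset.sum_sub_distrib, hβ]
    linarith
  have h := reflect _ hs β hβ (hback.symm ▸ hδ) hPs
  exact hP (hback ▸ h)

theorem inner_simple_nonpos {β γ : V} (hβ : β ∈ R.simple) (hγ : γ ∈ R.simple) (hne : β ≠ γ) :
    ⟪β, γ⟫ ≤ 0 := by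
  by_contra! h
  have hγγ : 0 < ⟪γ, γ⟫ := real_inner_self_pos.2 (R.ne_zero_of_mem_simple hγ)
  have hc := R.pos_coeff_nonneg _ (R.reflect_mem_pos (R.simple_subset hβ) hγ hne) γ hγ
  rw [R.coeff_sub _ _ hγ, R.coeff_smul _ _ hγ, R.coeff_simple hβ hγ, R.coeff_simple hγ hγ,
    if_neg hne.symm, if_pos rfl] at hc
  have : 0 < 2 * ⟪β, γ⟫ / ⟪γ, γ⟫ := by positivity
  linarith

theorem two_mul_inner_simple {β γ : V} (hβ : β ∈ R.simple) (hγ : γ ∈ R.simple) (hne : β ≠ γ)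
    (hnorm : ‖β‖ = ‖γ‖) (hinner : ⟪β, γ⟫ ≠ 0) : 2 * ⟪β, γ⟫ = -⟪γ, γ⟫ := by
  have hγγ : 0 < ⟪γ, γ⟫ := real_inner_self_pos.2 (R.ne_zero_of_mem_simple hγ)
  have hneg : ⟪β, γ⟫ < 0 := lt_of_le_of_ne (R.inner_simple_nonpos hβ hγ hne) hinner
  have hadd : β + γ ≠ 0 := fun h =>
    R.pos_neg_not γ (R.simple_subset hγ) (eq_neg_of_add_eq_zero_left h ▸ R.simple_subset hβ)
  have hpos : 0 < ⟪β + γ, β + γ⟫ := real_inner_self_pos.2 hadd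
  have hββ : ⟪β, β⟫ = ⟪γ, γ⟫ := by
    rw [real_inner_self_eq_norm_sq, real_inner_self_eq_norm_sq, hnorm]
  rw [real_inner_add_add_self, hββ] at hpos
  obtain ⟨m, hm⟩ := R.crystallographic β (R.pos_subset (R.simple_subset hβ)) γ
    (R.pos_subset (R.simple_subset hγ))
  rw [div_eq_iff hγγ.ne'] at hm
  have h1 : m < 0 := by
    by_contra! h
    have : (0 : ℝ) ≤ m := by exact_mod_cast h
    nlinarith
  have h2 : -2 < m := by
    by_contra! h
    have : (m : ℝ) ≤ -2 := by exact_mod_cast h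
    nlinarith
  obtain rfl : m = -1 := by omega
  simpa using hm

/-- The simple roots of `R` are `a 0, …, a (N - 1)`, forming a simply laced chain in this
order. -/
structure IsTypeA (N : ℕ) (a : ℕ → V) : Prop where
  mem_simple : ∀ {i}, i < N → a i ∈ R.simple
  exists_eq : ∀ {β}, β ∈ R.simple → ∃ i < N, a i = β
  inj : ∀ {i j}, i < N → j < N → a i = a j → i = j
  norm_eq : ∀ {i j}, i < N → j < N → ‖a i‖ = ‖a j‖
  inner_ne_zero_iff : ∀ {i j}, i < N → j < N →
    (⟪a i, a j⟫ ≠ 0 ↔ ((i : ℤ) - (j : ℤ)).natAbs ≤ 1)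

namespace IsTypeA

variable {R} {N : ℕ} {a : ℕ → V}

theorem coeff_simple (h : R.IsTypeA N a) {i j : ℕ} (hi : i < N) (hj : j < N) :
    R.coeff (a i) (a j) = if j = i then 1 else 0 := by
  rw [R.coeff_simple (h.mem_simple hi) (h.mem_simple hj)]
  by_cases hij : j = i
  · simp [hij]
  · rw [if_neg hij, if_neg fun e => hij (h.inj hj hi e)]

theorem coeff_sum_range (h : R.IsTypeA N a) {m j : ℕ} (hm : m ≤ N) (hj : j < N) :
    R.coeff (∑ i ∈ Finset.range m, a i) (a j) = if j < m then 1 else 0 := by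
  induction m with
  | zero => simpa using R.coeff_zero (h.mem_simple hj)
  | succ m ih =>
    rw [Finset.sum_range_succ, R.coeff_add _ _ (h.mem_simple hj), ih (by omega),
      h.coeff_simple (by omega) hj]
    grind

theorem two_mul_inner (h : R.IsTypeA N a) {i j : ℕ} (hi : i < N) (hj : j < N) :
    2 * ⟪a i, a j⟫ = ((if i = j then 2 else 0) - (if i = j + 1 then 1 else 0)
      - (if i + 1 = j then 1 else 0)) * ⟪a j, a j⟫ := by
  by_cases hij : i = j
  · subst hij
    simp
  by_cases hadj : i = j + 1 ∨ i + 1 = j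
  · rw [R.two_mul_inner_simple (h.mem_simple hi) (h.mem_simple hj)
      (fun e => hij (h.inj hi hj e)) (h.norm_eq hi hj)
      ((h.inner_ne_zero_iff hi hj).2 (by omega))]
    rcases hadj with hadj | hadj
    · rw [if_neg hij, if_pos hadj, if_neg (by omega)]
      ring
    · rw [if_neg hij, if_pos hadj, if_neg (by omega)]
      ring
  · have h0 : ⟪a i, a j⟫ = 0 := by
      by_contra h0
      have := (h.inner_ne_zero_iff hi hj).1 h0
      omega
    rw [h0, if_neg hij, if_neg (by omega), if_neg (by omega)]
    ring

theorem two_mul_inner_sum_range (h : R.IsTypeA N a) {m j : ℕ} (hm : m ≤ N) (hj : j < N) :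
    2 * ⟪∑ i ∈ Finset.range m, a i, a j⟫ = ((if m = j + 1 then 1 else 0)
      - (if m = j then 1 else 0) + (if j = 0 then 1 else 0)) * ⟪a j, a j⟫ := by
  induction m with
  | zero =>
    by_cases h0 : j = 0
    · simp [h0]
    · simp [h0, Ne.symm h0]
  | succ m ih =>
    rw [Finset.sum_range_succ, inner_add_left, mul_add, ih (by omega),
      h.two_mul_inner (by omega) hj, ← add_mul]
    congr 1
    grind

theorem cartan_sub_sum_range (h : R.IsTypeA N a) {l m j : ℕ} (hl : l ≤ N) (hm : m ≤ N)
    (hj : j < N) :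
    2 * ⟪∑ i ∈ Finset.range m, a i - ∑ i ∈ Finset.range l, a i, a j⟫ / ⟪a j, a j⟫
      = (if m = j + 1 then 1 else 0) - (if m = j then 1 else 0)
        - (if l = j + 1 then 1 else 0) + (if l = j then 1 else 0) := by
  have hjj : ⟪a j, a j⟫ ≠ 0 :=
    (real_inner_self_pos.2 (R.ne_zero_of_mem_simple (h.mem_simple hj))).ne'
  rw [div_eq_iff hjj, inner_sub_left, mul_sub, h.two_mul_inner_sum_range hm hj,
    h.two_mul_inner_sum_range hl hj]
  ring

theorem lt_of_sub_sum_range_mem_pos (h : R.IsTypeA N a) {l m : ℕ} (hl : l ≤ N)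
    (hpos : ∑ i ∈ Finset.range m, a i - ∑ i ∈ Finset.range l, a i ∈ R.pos)
    (hm : m ≤ N) : l < m := by
  rcases lt_trichotomy l m with hlm | rfl | hlm
  · exact hlm
  · exact absurd (sub_self _) (R.root_ne_zero _ (R.pos_subset hpos))
  · have hc := R.pos_coeff_nonneg _ hpos (a m) (h.mem_simple (by omega))
    rw [R.coeff_sub _ _ (h.mem_simple (by omega)), h.coeff_sum_range hm (by omega),
      h.coeff_sum_range hl (by omega), if_neg (lt_irrefl m), if_pos hlm] at hc
    norm_num at hc

/-- Every positive root in type `A` is a sum of consecutive simple roots. -/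
theorem exists_eq_sub_sum_range (h : R.IsTypeA N a) {δ : V} (hδ : δ ∈ R.pos) :
    ∃ l m, l < m ∧ m ≤ N ∧
      δ = ∑ i ∈ Finset.range m, a i - ∑ i ∈ Finset.range l, a i := by
  refine R.pos_induction (P := fun δ => ∃ l m, l < m ∧ m ≤ N ∧
    δ = ∑ i ∈ Finset.range m, a i - ∑ i ∈ Finset.range l, a i) ?_ ?_ δ hδ
  · intro β hβ
    obtain ⟨i, hi, rfl⟩ := h.exists_eq hβ
    exact ⟨i, i + 1, by omega, by omega, by simp [Finset.sum_range_succ]⟩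
  · rintro δ - β hβ hpos ⟨l, m, hlm, hm, rfl⟩
    obtain ⟨j, hj, rfl⟩ := h.exists_eq hβ
    suffices ∃ l' m', l' ≤ N ∧ m' ≤ N ∧
        ∑ i ∈ Finset.range m, a i - ∑ i ∈ Finset.range l, a i
          - (2 * ⟪∑ i ∈ Finset.range m, a i - ∑ i ∈ Finset.range l, a i, a j⟫ /
            ⟪a j, a j⟫) • a j
          = ∑ i ∈ Finset.range m', a i - ∑ i ∈ Finset.range l', a i by
      obtain ⟨l', m', hl', hm', he⟩ := this
      rw [he] at hpos ⊢
      exact ⟨l', m', h.lt_of_sub_sum_range_mem_pos hl' hpos hm', hm', rfl⟩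
    refine ⟨if l = j then j + 1 else if l = j + 1 then j else l,
      if m = j then j + 1 else if m = j + 1 then j else m, by grind, by grind, ?_⟩
    rw [h.cartan_sub_sum_range (by omega) hm hj]
    have hsucc := Finset.sum_range_succ a j
    by_cases h1 : l = j <;> by_cases h2 : l = j + 1 <;> by_cases h3 : m = j <;>
      by_cases h4 : m = j + 1 <;> try omega
    all_goals
      simp only [h1, h2, h3, h4, hsucc, if_true, if_false, Nat.succ_ne_self,
        (Nat.succ_ne_self j).symm]
      module

theorem sub_sum_range_mem_pos (h : R.IsTypeA N a) {l m : ℕ} (hlm : l < m) (hm : m ≤ N) :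
    ∑ i ∈ Finset.range m, a i - ∑ i ∈ Finset.range l, a i ∈ R.pos := by
  induction m, hlm using Nat.le_induction with
  | base =>
    rw [Finset.sum_range_succ, add_sub_cancel_left]
    exact R.simple_subset (h.mem_simple hm)
  | succ m hlm ih =>
    have hne : ∑ i ∈ Finset.range m, a i - ∑ i ∈ Finset.range l, a i ≠ a m := by
      intro he
      have hc := congrArg (R.coeff · (a m)) he
      simp only [R.coeff_sub _ _ (h.mem_simple hm)] at hc
      rw [h.coeff_sum_range (by omega) hm, h.coeff_sum_range (by omega) hm,
        h.coeff_simple hm hm, if_neg (by omega), if_neg (by omega), if_pos rfl] at hc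
      norm_num at hc
    have hpos := R.reflect_mem_pos (ih (by omega)) (h.mem_simple hm) hne
    rw [h.cartan_sub_sum_range (by omega) (by omega) hm, if_neg (by omega), if_pos rfl,
      if_neg (by omega), if_neg (by omega)] at hpos
    rw [Finset.sum_range_succ]
    convert hpos using 1
    module

theorem isABRoot_iff (h : R.IsTypeA N a) {r : ℕ} (hr : r < N) {δ : V} :
    R.IsABRoot {a r} ((Finset.range r).image a) δ ↔
      ∃ l < r + 1, ∑ i ∈ Finset.range (r + 1), a i - ∑ i ∈ Finset.range l, a i = δ := by
  constructor
  · rintro ⟨hpos, hsupp, β, hβ, hc⟩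
    rw [Finset.mem_singleton.1 hβ] at hc
    obtain ⟨l, m, hlm, hm, rfl⟩ := h.exists_eq_sub_sum_range hpos
    have hcoeff : ∀ j < N,
        R.coeff (∑ i ∈ Finset.range m, a i - ∑ i ∈ Finset.range l, a i) (a j)
          = (if j < m then 1 else 0) - (if j < l then 1 else 0) := fun j hj => by
      rw [R.coeff_sub _ _ (h.mem_simple hj), h.coeff_sum_range hm hj,
        h.coeff_sum_range (by omega) hj]
    rw [hcoeff r hr] at hc
    have hlr : l ≤ r := by
      by_contra! hlt
      rw [if_pos (by omega), if_pos hlt] at hc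
      norm_num at hc
    have hrm : r < m := by
      by_contra! hle
      rw [if_neg (by omega), if_neg (by omega)] at hc
      norm_num at hc
    suffices m = r + 1 from ⟨l, by omega, by rw [this]⟩
    by_contra hne
    have hr1 : r + 1 < N := by omega
    have hmem := hsupp (Finset.mem_filter.2 ⟨h.mem_simple hr1, by
      rw [hcoeff _ hr1, if_pos (by omega), if_neg (by omega)]
      norm_num⟩)
    simp only [Finset.mem_union, Finset.mem_singleton, Finset.mem_image,
      Finset.mem_range] at hmem
    rcases hmem with hmem | ⟨i, hi, hmem⟩
    · have := h.inj hr1 hr hmem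
      omega
    · have := h.inj (by omega) hr1 hmem
      omega
  · rintro ⟨l, hl, rfl⟩
    refine ⟨h.sub_sum_range_mem_pos hl hr, ?_, a r, Finset.mem_singleton_self _, ?_⟩
    · intro β hβ
      obtain ⟨hβ, hne⟩ := Finset.mem_filter.1 hβ
      obtain ⟨j, hj, rfl⟩ := h.exists_eq hβ
      rw [R.coeff_sub _ _ hβ, h.coeff_sum_range hr hj, h.coeff_sum_range (by omega) hj] at hne
      have hjr : j < r + 1 := by
        by_contra! hle
        rw [if_neg (by omega), if_neg (by omega)] at hne
        norm_num at hne
      rcases Nat.lt_succ_iff_lt_or_eq.1 hjr with hjr | rfl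
      · exact Finset.mem_union_right _ (Finset.mem_image_of_mem a (Finset.mem_range.2 hjr))
      · exact Finset.mem_union_left _ (Finset.mem_singleton_self _)
    · rw [R.coeff_sub _ _ (h.mem_simple hr), h.coeff_sum_range hr hr,
        h.coeff_sum_range (by omega) hr, if_pos (by omega), if_neg (by omega)]
      norm_num

theorem isSignificant (h : R.IsTypeA N a) {r : ℕ} (hr : r < N) {δ : V}
    (hδ : R.IsABRoot {a r} ((Finset.range r).image a) δ) :
    R.IsSignificant {a r} ((Finset.range r).image a) δ := by
  have hnorm : ∀ β ∈ R.simple, ‖β‖ = ‖a r‖ := fun β hβ => by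
    obtain ⟨j, hj, rfl⟩ := h.exists_eq hβ
    exact h.norm_eq hj hr
  have hsupp : ∀ β ∈ R.support (δ - a r), ‖β‖ = ‖a r‖ := fun β hβ =>
    hnorm β (Finset.mem_filter.1 hβ).1
  refine ⟨hδ, a r, ?_, ?_, ?_, fun x hx y hy => (hsupp x hx).trans (hsupp y hy).symm,
    fun x hx => (hsupp x hx).le⟩
  · exact (h.isABRoot_iff hr).2 ⟨r, by omega, by simp [Finset.sum_range_succ]⟩
  · obtain ⟨l, hl, rfl⟩ := (h.isABRoot_iff hr).1 hδ
    intro β hβ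
    obtain ⟨j, hj, rfl⟩ := h.exists_eq hβ
    have hnonneg := R.pos_coeff_nonneg _ hδ.1 _ hβ
    rw [h.coeff_simple hr hj]
    split_ifs with hjr
    · subst hjr
      rw [R.coeff_sub _ _ hβ, h.coeff_sum_range hr hr, h.coeff_sum_range (by omega) hr,
        if_pos (by omega), if_neg (by omega), sub_zero]
    · exact hnonneg
  · rw [Finset.sum_eq_zero]
    · rw [Finset.sum_singleton, h.coeff_simple hr hr, if_pos rfl, one_mul]
      exact real_inner_self_nonneg
    · intro β hβ
      obtain ⟨j, hj, rfl⟩ := Finset.mem_image.1 hβ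
      have hjr := Finset.mem_range.1 hj
      rw [h.coeff_simple hr (by omega), if_neg (by omega), zero_mul]

theorem sum_range_injOn (h : R.IsTypeA N a) :
    Set.InjOn (fun m => ∑ i ∈ Finset.range m, a i) (Set.Iic N) := by
  have key : ∀ l m, l < m → m ≤ N →
      ∑ i ∈ Finset.range l, a i ≠ ∑ i ∈ Finset.range m, a i := fun l m hlm hm he =>
    R.root_ne_zero _ (R.pos_subset (h.sub_sum_range_mem_pos hlm hm)) (sub_eq_zero.2 he.symm)
  intro l hl m hm he
  rcases lt_trichotomy l m with hlm | hlm | hlm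
  · exact absurd he (key l m hlm hm)
  · exact hlm
  · exact absurd he.symm (key m l hlm hl)

theorem ell_eq (h : R.IsTypeA N a) {r : ℕ} (hr : r < N) :
    R.ell {a r} ((Finset.range r).image a) = r + 1 := by
  have himage : (R.pos.filter fun δ => R.IsSignificant {a r} ((Finset.range r).image a) δ)
      = (Finset.range (r + 1)).image fun l =>
        ∑ i ∈ Finset.range (r + 1), a i - ∑ i ∈ Finset.range l, a i := by
    ext δ
    simp only [Finset.mem_filter, Finset.mem_image, Finset.mem_range]
    rw [← h.isABRoot_iff hr]
    exact ⟨fun hδ => hδ.2.1, fun hδ => ⟨hδ.1, h.isSignificant hr hδ⟩⟩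
  rw [ell, himage, Finset.card_image_of_injOn, Finset.card_range]
  intro l hl m hm he
  have hl := Finset.mem_range.1 (Finset.mem_coe.1 hl)
  have hm := Finset.mem_range.1 (Finset.mem_coe.1 hm)
  exact h.sum_range_injOn (Set.mem_Iic.2 (by omega)) (Set.mem_Iic.2 (by omega))
    (sub_right_injective he)

end IsTypeA

end RootSystemData

/-- In the root system of type `A_{n−1}` with simple roots `α₁, …, α_{n−1}` in the
standard order, with `A = {α_k}` and `B = {α₁, …, α_{k−1}}`, every `(A,B)`-root is
significant and `ℓ(A,B) = k`. -/
theorem ell_type_A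
    {V : Type*} [NormedAddCommGroup V] [InnerProductSpace ℝ V]
    (R : RootSystemData V)
    (n : ℕ) (hn : 2 ≤ n)
    (α : Fin (n - 1) → V) (hinj : Function.Injective α)
    (himg : R.simple = Finset.image α Finset.univ)
    (hlen : ∀ i j, ‖α i‖ = ‖α j‖)
    (hadj : ∀ i j : Fin (n - 1), ⟪α i, α j⟫ ≠ 0 ↔ ((i : ℤ) - (j : ℤ)).natAbs ≤ 1)
    (k : ℕ) (hk1 : 1 ≤ k) (hk2 : k ≤ n - 1)
    (A B : Finset V)
    (hA : A = {α ⟨k - 1, by omega⟩})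
    (hB : B = Finset.image α (Finset.univ.filter fun i : Fin (n - 1) => (i : ℕ) < k - 1)) :
    (∀ δ : V, R.IsABRoot A B δ → R.IsSignificant A B δ) ∧ R.ell A B = k := by
  set a : ℕ → V := fun i => if hi : i < n - 1 then α ⟨i, hi⟩ else 0 with ha
  have haα : ∀ {i} (hi : i < n - 1), a i = α ⟨i, hi⟩ := fun hi => dif_pos hi
  have h : R.IsTypeA (n - 1) a :=
    { mem_simple := fun hi => by
        rw [haα hi, himg]
        exact Finset.mem_image_of_mem α (Finset.mem_univ _)
      exists_eq := fun hβ => by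
        rw [himg] at hβ
        obtain ⟨i, -, rfl⟩ := Finset.mem_image.1 hβ
        exact ⟨i, i.2, haα i.2⟩
      inj := fun hi hj he => by
        rw [haα hi, haα hj] at he
        exact congrArg Fin.val (hinj he)
      norm_eq := fun hi hj => by
        rw [haα hi, haα hj]
        exact hlen _ _
      inner_ne_zero_iff := fun hi hj => by
        rw [haα hi, haα hj]
        exact hadj _ _ }
  have hr : k - 1 < n - 1 := by omega
  have hA' : A = {a (k - 1)} := by rw [hA, haα hr]
  have hB' : B = (Finset.range (k - 1)).image a := by
    rw [hB]
    ext β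
    simp only [Finset.mem_image, Finset.mem_filter, Finset.mem_univ, true_and,
      Finset.mem_range]
    constructor
    · rintro ⟨i, hi, rfl⟩
      exact ⟨i, hi, haα i.2⟩
    · rintro ⟨i, hi, rfl⟩
      exact ⟨⟨i, by omega⟩, hi, (haα (by omega)).symm⟩
  rw [hA', hB']
  refine ⟨fun δ hδ => h.isSignificant hr hδ, ?_⟩
  rw [h.ell_eq hr]
  omega
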